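/- arXiv:1411.2417 — 2 statements merged into one kernel-verified Lean document; each statement's English description precedes it below -/
import Mathlib

section
/- For any code over a combination network with two public receivers and private receiver p achieving vanishing error probability, the rates satisfy 2R₁ + R₂ ≤ |E_{{1}}| + 2|E_{{1,2}}| + |E_{{2}}| + |E_{φ,p}|. The proof step is: nR₂ ≤ H(Xⁿ_{{1},{1,2}}) + H(Xⁿ_{{2},{1,2}}) − 2nR₁ + H(Xⁿ_{φ,p}) + 3nε, using submodularity of entropy, Fano's inequality, and H(Xⁿ_S) ≤ n|E_S|. -/
/-- Shannon entropy (in nats) of a finite-valued random variable on a finite probability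
space with mass function `pr`. -/
noncomputable def ent {Ω β : Type*} [Fintype Ω] [Fintype β] [DecidableEq β]
    (pr : Ω → ℝ) (f : Ω → β) : ℝ :=
  ∑ b : β, Real.negMulLog (∑ ω ∈ Finset.univ.filter fun ω => f ω = b, pr ω)

/-- The probability that `f` takes the value `b` under the mass function `pr`. -/
noncomputable def marginal {Ω β : Type*} [Fintype Ω] [DecidableEq β]
    (pr : Ω → ℝ) (f : Ω → β) (b : β) : ℝ :=
  ∑ ω ∈ Finset.univ.filter fun ω => f ω = b, pr ω

section Entropy

variable {Ω α β γ : Type*} [Fintype Ω] [DecidableEq α] [DecidableEq β] [DecidableEq γ]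
  {pr : Ω → ℝ}

theorem marginal_nonneg (hpr : ∀ ω, 0 ≤ pr ω) (f : Ω → β) (b : β) : 0 ≤ marginal pr f b :=
  Finset.sum_nonneg fun ω _ => hpr ω

theorem le_marginal (hpr : ∀ ω, 0 ≤ pr ω) (f : Ω → β) (ω : Ω) : pr ω ≤ marginal pr f (f ω) :=
  Finset.single_le_sum (f := pr) (fun i _ => hpr i) (by simp)

theorem marginal_pos (hpr : ∀ ω, 0 ≤ pr ω) (f : Ω → β) {ω : Ω} (hω : 0 < pr ω) :
    0 < marginal pr f (f ω) :=
  hω.trans_le (le_marginal hpr f ω)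

variable [Fintype β]

theorem sum_marginal_mul (f : Ω → β) (φ : β → ℝ) :
    ∑ b, marginal pr f b * φ b = ∑ ω, pr ω * φ (f ω) := by
  rw [← Finset.sum_fiberwise Finset.univ f fun ω => pr ω * φ (f ω)]
  refine Finset.sum_congr rfl fun b _ => ?_
  rw [marginal, Finset.sum_mul]
  refine Finset.sum_congr rfl fun ω hω => ?_
  rw [(Finset.mem_filter.mp hω).2]

theorem sum_marginal (f : Ω → β) : ∑ b, marginal pr f b = ∑ ω, pr ω := by
  simpa using sum_marginal_mul (pr := pr) f fun _ => 1

theorem sum_marginal_prodMk (f : Ω → α) (g : Ω → β) (a : α) :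
    ∑ b, marginal pr (fun ω => (f ω, g ω)) (a, b) = marginal pr f a := by
  unfold marginal
  rw [← Finset.sum_fiberwise (Finset.univ.filter fun ω => f ω = a) g pr]
  refine Finset.sum_congr rfl fun b _ => Finset.sum_congr ?_ fun _ _ => rfl
  ext ω
  simp

variable [Fintype α] [Fintype γ]

theorem ent_eq_neg_sum (f : Ω → β) :
    ent pr f = -∑ ω, pr ω * Real.log (marginal pr f (f ω)) := by
  rw [← sum_marginal_mul f fun b => Real.log (marginal pr f b), ← Finset.sum_neg_distrib]
  refine Finset.sum_congr rfl fun b _ => ?_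
  change Real.negMulLog (marginal pr f b) = _
  rw [Real.negMulLog, neg_mul]

/-- **Gibbs' inequality**: entropy is at most the cross-entropy with a sub-probability `r`. -/
theorem ent_le_cross_entropy (hpr : ∀ ω, 0 ≤ pr ω) (h1 : ∑ ω, pr ω = 1) (f : Ω → β)
    (r : β → ℝ) (hr : ∀ b, 0 ≤ r b) (hsum : ∑ b, r b ≤ 1)
    (hpos : ∀ ω, 0 < pr ω → 0 < r (f ω)) :
    ent pr f ≤ -∑ ω, pr ω * Real.log (r (f ω)) := by
  have pointwise : ∀ ω, pr ω * Real.log (r (f ω)) - pr ω * Real.log (marginal pr f (f ω))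
      ≤ pr ω * (r (f ω) / marginal pr f (f ω)) - pr ω := by
    intro ω
    rcases (hpr ω).eq_or_lt with h | h
    · simp [← h]
    · have hm : 0 < marginal pr f (f ω) := marginal_pos hpr f h
      have := Real.log_le_sub_one_of_pos (div_pos (hpos ω h) hm)
      rw [Real.log_div (hpos ω h).ne' hm.ne'] at this
      nlinarith
  have total := Finset.sum_le_sum fun ω (_ : ω ∈ Finset.univ) => pointwise ω
  have mass : ∑ ω, pr ω * (r (f ω) / marginal pr f (f ω)) ≤ ∑ b, r b := by
    rw [← sum_marginal_mul f fun b => r b / marginal pr f b]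
    refine Finset.sum_le_sum fun b _ => ?_
    rcases (marginal_nonneg hpr f b).eq_or_lt with h | h
    · simpa [← h] using hr b
    · rw [mul_div_cancel₀ _ h.ne']
  simp only [Finset.sum_sub_distrib] at total
  rw [ent_eq_neg_sum]
  linarith

theorem ent_le_log_card [Nonempty β] (hpr : ∀ ω, 0 ≤ pr ω) (h1 : ∑ ω, pr ω = 1) (f : Ω → β) :
    ent pr f ≤ Real.log (Fintype.card β) := by
  have hc : (0 : ℝ) < Fintype.card β := by exact_mod_cast Fintype.card_pos
  have := ent_le_cross_entropy hpr h1 f (fun _ => (Fintype.card β : ℝ)⁻¹)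
    (fun _ => by positivity) (by simp [hc.ne']) (fun _ _ => by positivity)
  rwa [← Finset.sum_mul, h1, one_mul, Real.log_inv, neg_neg] at this

/-- Entropy does not increase under a function. -/
theorem ent_comp_le (hpr : ∀ ω, 0 ≤ pr ω) (f : Ω → α) (g : α → β) :
    ent pr (fun ω => g (f ω)) ≤ ent pr f := by
  rw [ent_eq_neg_sum, ent_eq_neg_sum, neg_le_neg_iff]
  refine Finset.sum_le_sum fun ω _ => ?_
  rcases (hpr ω).eq_or_lt with h | h
  · simp [← h]
  · refine mul_le_mul_of_nonneg_left (Real.log_le_log (marginal_pos hpr f h) ?_) h.le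
    refine Finset.sum_le_sum_of_subset_of_nonneg (fun i hi => ?_) fun i _ _ => hpr i
    simp only [Finset.mem_filter, Finset.mem_univ, true_and] at hi ⊢
    rw [hi]

/-- Submodularity of entropy. -/
theorem ent_submodular (hpr : ∀ ω, 0 ≤ pr ω) (h1 : ∑ ω, pr ω = 1)
    (f : Ω → α) (g : Ω → β) (h : Ω → γ) :
    ent pr (fun ω => (f ω, g ω, h ω)) + ent pr f
      ≤ ent pr (fun ω => (f ω, g ω)) + ent pr (fun ω => (f ω, h ω)) := by
  set fg : Ω → α × β := fun ω => (f ω, g ω) with hfg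
  set fh : Ω → α × γ := fun ω => (f ω, h ω) with hfh
  have gibbs := ent_le_cross_entropy hpr h1 (fun ω => (f ω, g ω, h ω))
    (fun x => marginal pr fg (x.1, x.2.1) * marginal pr fh (x.1, x.2.2) / marginal pr f x.1)
    (fun x => div_nonneg (mul_nonneg (marginal_nonneg hpr _ _) (marginal_nonneg hpr _ _))
      (marginal_nonneg hpr _ _))
    (by
      rw [Fintype.sum_prod_type, ← h1, ← sum_marginal f]
      refine Finset.sum_le_sum fun a _ => ?_
      simp only [← Finset.sum_div]
      rw [Fintype.sum_prod_type]
      simp only [← Finset.mul_sum]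
      rw [← Finset.sum_mul, hfg, hfh, sum_marginal_prodMk, sum_marginal_prodMk, mul_self_div_self])
    (fun ω hω => div_pos (mul_pos (marginal_pos hpr fg hω) (marginal_pos hpr fh hω))
      (marginal_pos hpr f hω))
  have split : ∀ ω, pr ω * Real.log (marginal pr fg (f ω, g ω) * marginal pr fh (f ω, h ω)
        / marginal pr f (f ω))
      = pr ω * Real.log (marginal pr fg (fg ω)) + pr ω * Real.log (marginal pr fh (fh ω))
        - pr ω * Real.log (marginal pr f (f ω)) := by
    intro ω
    rcases (hpr ω).eq_or_lt with hω | hω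
    · simp [← hω]
    · have pg := marginal_pos hpr fg hω
      have ph := marginal_pos hpr fh hω
      rw [← mul_add, ← mul_sub, ← Real.log_mul pg.ne' ph.ne',
        ← Real.log_div (mul_pos pg ph).ne' (marginal_pos hpr f hω).ne']
  simp only [split, Finset.sum_sub_distrib, Finset.sum_add_distrib] at gibbs
  rw [ent_eq_neg_sum f, ent_eq_neg_sum fg, ent_eq_neg_sum fh]
  linarith

/-- Subadditivity of entropy. -/
theorem ent_prodMk_le_add (hpr : ∀ ω, 0 ≤ pr ω) (h1 : ∑ ω, pr ω = 1) (f : Ω → α) (g : Ω → β) :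
    ent pr (fun ω => (f ω, g ω)) ≤ ent pr f + ent pr g := by
  have sub := ent_submodular hpr h1 (fun _ => ()) f g
  have zero : ent pr (fun _ : Ω => ()) = 0 := by simp [ent, h1]
  have pair := ent_comp_le hpr (fun ω => ((), f ω, g ω)) Prod.snd
  have left := ent_comp_le hpr f fun a => ((), a)
  have right := ent_comp_le hpr g fun b => ((), b)
  linarith

/-- The entropic converse: if `W` can be decoded from `(A, B)` and from `(C, B)`, and `V` from `W`
and a function of `(A, B, C, D)`, each up to equivocation `η`, then `2 H(W) + H(V | W)` is bounded
by the entropies of `A`, `B`, `C`, `D`, that of `B` counted twice. -/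
theorem two_mul_ent_add_le {ι κ ζ δ : Type*} [Fintype ι] [DecidableEq ι] [Fintype κ]
    [DecidableEq κ] [Fintype ζ] [DecidableEq ζ] [Fintype δ] [DecidableEq δ]
    (hpr : ∀ ω, 0 ≤ pr ω) (h1 : ∑ ω, pr ω = 1) {W : Ω → ι} {V : Ω → κ} {A : Ω → α} {B : Ω → β}
    {C : Ω → γ} {D : Ω → δ} {Y : Ω → ζ} {η : ℝ} (g : α → β → γ → δ → ζ)
    (hY : ∀ ω, Y ω = g (A ω) (B ω) (C ω) (D ω))
    (hA : ent pr (fun ω => (W ω, A ω, B ω)) - ent pr (fun ω => (A ω, B ω)) ≤ η)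
    (hC : ent pr (fun ω => (W ω, C ω, B ω)) - ent pr (fun ω => (C ω, B ω)) ≤ η)
    (hV : ent pr (fun ω => (W ω, V ω, Y ω)) - ent pr (fun ω => (W ω, Y ω)) ≤ η) :
    2 * ent pr W + (ent pr (fun ω => (W ω, V ω)) - ent pr W)
      ≤ ent pr A + 2 * ent pr B + ent pr C + ent pr D + 3 * η := by
  have messages : ent pr (fun ω => (W ω, V ω)) ≤ ent pr (fun ω => (W ω, V ω, Y ω)) :=
    ent_comp_le hpr (fun ω => (W ω, V ω, Y ω)) fun x => (x.1, x.2.1)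
  have observed : ent pr (fun ω => (W ω, Y ω))
      ≤ ent pr (fun ω => (((W ω, B ω), A ω, C ω), D ω)) := by
    simp only [hY]
    exact ent_comp_le hpr (fun ω => (((W ω, B ω), A ω, C ω), D ω))
      fun x => (x.1.1.1, g x.1.2.1 x.1.1.2 x.1.2.2 x.2)
  have split := ent_prodMk_le_add hpr h1 (fun ω => ((W ω, B ω), A ω, C ω)) D
  have submod := ent_submodular hpr h1 (fun ω => (W ω, B ω)) A C
  have common : ent pr W ≤ ent pr (fun ω => (W ω, B ω)) :=
    ent_comp_le hpr (fun ω => (W ω, B ω)) Prod.fst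
  have reorderA : ent pr (fun ω => ((W ω, B ω), A ω)) ≤ ent pr (fun ω => (W ω, A ω, B ω)) :=
    ent_comp_le hpr (fun ω => (W ω, A ω, B ω)) fun x => ((x.1, x.2.2), x.2.1)
  have reorderC : ent pr (fun ω => ((W ω, B ω), C ω)) ≤ ent pr (fun ω => (W ω, C ω, B ω)) :=
    ent_comp_le hpr (fun ω => (W ω, C ω, B ω)) fun x => ((x.1, x.2.2), x.2.1)
  have pairA := ent_prodMk_le_add hpr h1 A B
  have pairC := ent_prodMk_le_add hpr h1 C B
  linarith

end Entropy

theorem log_card_symbols (e n q : ℕ) :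
    Real.log (Fintype.card (Fin e → Fin n → Fin q)) = n * e * Real.log q := by
  simp only [Fintype.card_pi, Fintype.card_fin, Finset.prod_const, Finset.card_univ]
  push_cast
  rw [Real.log_pow, Real.log_pow]
  ring

/-- The entropy of length-`n` symbol sequences on `e` edges is at most `n * e` symbols. -/
theorem ent_symbols_le {Ω : Type*} [Fintype Ω] {pr : Ω → ℝ} (hpr : ∀ ω, 0 ≤ pr ω)
    (h1 : ∑ ω, pr ω = 1) {e n q : ℕ} (hq : 0 < q) (f : Ω → Fin e → Fin n → Fin q) :
    ent pr f ≤ n * e * Real.log q := by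
  have : NeZero q := ⟨hq.ne'⟩
  exact (ent_le_log_card hpr h1 f).trans_eq (log_card_symbols e n q)

/-- over a combination network with two public receivers and a private
receiver `p`, any code with (Fano-type) vanishing decoding error satisfies
`2R₁ + R₂ ≤ |E_{{1}}| + 2|E_{{1,2}}| + |E_{{2}}| + |E_{φ,p}|` (up to the `ε`-slack `3ε`).
Rates are measured in units of `log q`; `X S` are the length-`n` symbol sequences on the
`E S` resource edges seen exactly by the public receivers in `S`, of which the first
`Ep S` also reach the private receiver. -/
theorem stmt16 {Ω : Type} [Fintype Ω]
    (pr : Ω → ℝ) (hpr0 : ∀ ω, 0 ≤ pr ω) (hpr1 : ∑ ω, pr ω = 1)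
    (n q M1 M2 : ℕ) (hn : 0 < n) (hq : 1 < q)
    (E Ep : Finset (Fin 2) → ℕ) (hEpE : ∀ S, Ep S ≤ E S)
    (R1 R2 ε : ℝ) (hε : 0 ≤ ε)
    (W1 : Ω → Fin M1) (W2 : Ω → Fin M2)
    (X : (S : Finset (Fin 2)) → Ω → (Fin (E S) → Fin n → Fin q))
    -- W₁ uniform of rate R₁ : H(W₁) = n R₁ log q
    (hR1 : ent pr W1 = n * R1 * Real.log q)
    -- W₂ independent of W₁, uniform of rate R₂ : H(W₂ | W₁) = n R₂ log q
    (hR2 : ent pr (fun ω => (W1 ω, W2 ω)) - ent pr W1 = n * R2 * Real.log q)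
    -- Fano at public receiver 1 : H(W₁ | Xⁿ_{{1}}, Xⁿ_{{1,2}}) ≤ n ε log q
    (hFano1 : ent pr (fun ω => (W1 ω, X {0} ω, X {0, 1} ω))
        - ent pr (fun ω => (X {0} ω, X {0, 1} ω)) ≤ n * ε * Real.log q)
    -- Fano at public receiver 2 : H(W₁ | Xⁿ_{{2}}, Xⁿ_{{1,2}}) ≤ n ε log q
    (hFano2 : ent pr (fun ω => (W1 ω, X {1} ω, X {0, 1} ω))
        - ent pr (fun ω => (X {1} ω, X {0, 1} ω)) ≤ n * ε * Real.log q)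
    -- Fano at private receiver p : H(W₂ | W₁, Yⁿ_p) ≤ n ε log q
    (hFanop : ent pr (fun ω => (W1 ω, W2 ω,
          (fun S (k : Fin (Ep S)) => X S ω (Fin.castLE (hEpE S) k) :
            (S : Finset (Fin 2)) → Fin (Ep S) → Fin n → Fin q)))
        - ent pr (fun ω => (W1 ω,
          (fun S (k : Fin (Ep S)) => X S ω (Fin.castLE (hEpE S) k) :
            (S : Finset (Fin 2)) → Fin (Ep S) → Fin n → Fin q)))
        ≤ n * ε * Real.log q) :
    2 * R1 + R2
      ≤ (E {0} : ℝ) + 2 * (E {0, 1} : ℝ) + (E {1} : ℝ) + (Ep ∅ : ℝ) + 3 * ε := by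
  have hq0 : 0 < q := by omega
  let Y : Ω → (S : Finset (Fin 2)) → Fin (Ep S) → Fin n → Fin q :=
    fun ω S k => X S ω (Fin.castLE (hEpE S) k)
  let D : Ω → Fin (Ep ∅) → Fin n → Fin q := fun ω k => X ∅ ω (Fin.castLE (hEpE ∅) k)
  have cover : ∀ S : Finset (Fin 2), S ≠ ∅ → S ≠ {0} → S ≠ {1} → S = {0, 1} := by decide
  have converse := two_mul_ent_add_le hpr0 hpr1 (W := W1) (V := W2) (A := X {0}) (B := X {0, 1})
    (C := X {1}) (D := D) (Y := Y)
    (fun a b c d S (k : Fin (Ep S)) =>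
      if h0 : S = ∅ then d (Fin.cast (by rw [h0]) k)
      else if h1 : S = {0} then a (Fin.cast (by rw [h1]) (Fin.castLE (hEpE S) k))
      else if h2 : S = {1} then c (Fin.cast (by rw [h2]) (Fin.castLE (hEpE S) k))
      else b (Fin.cast (by rw [cover S h0 h1 h2]) (Fin.castLE (hEpE S) k)))
    (fun ω => by
      funext S k
      split_ifs with h0 h1 h2
      · subst h0; rfl
      · subst h1; rfl
      · subst h2; rfl
      · obtain rfl := cover S h0 h1 h2
        rfl)
    hFano1 hFano2 (by convert hFanop)
  have card0 := ent_symbols_le hpr0 hpr1 hq0 (X {0})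
  have card1 := ent_symbols_le hpr0 hpr1 hq0 (X {1})
  have card01 := ent_symbols_le hpr0 hpr1 hq0 (X {0, 1})
  have cardD := ent_symbols_le hpr0 hpr1 hq0 D
  have scale : 0 < (n : ℝ) * Real.log q :=
    mul_pos (by exact_mod_cast hn) (Real.log_pos (by exact_mod_cast hq))
  rw [hR1] at converse hR2
  refine le_of_mul_le_mul_left ?_ scale
  linarith
end

section
/- In the rate region defined by constraints (structural) R₂ = Σ_{S⊆{1,2,3}} α_S with α_S ≥ 0 for S ≠ φ; (public) R₁ + Σ_{S∋i} α_S ≤ Σ_{S∋i}|E_S|; (private) R₂ ≤ Σ_{S∈Λ} α_S + Σ_{S∈Λᶜ}|E_{S,p}| for all superset-saturated Λ and all p, and R₁+R₂ ≤ Σ_S |E_{S,p}|; the constraint family 'α_S ≥ 0 for all S ≠ φ' can be replaced by 'Σ_{S∈Λ} α_S ≥ 0 for all superset-saturated Λ ⊆ 2^{{1,2,3}}' without changing the projection onto (R₁,R₂). -/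
/-- A superset-saturated family of subsets of `{1,2,3}`. -/
def Saturated (Λ : Finset (Finset (Fin 3))) : Prop :=
  ∀ S ∈ Λ, ∀ T : Finset (Fin 3), S ⊆ T → T ∈ Λ

open Finset in
/-- `β` is at least as good as `α`: it has the same total and no larger star sums, and each of its
saturated sums dominates a saturated sum of `α` over a larger family. -/
structure Improves (α β : Finset (Fin 3) → ℝ) : Prop where
  total : ∑ S, β S = ∑ S, α S
  star : ∀ i : Fin 3, ∑ S ∈ univ.filter (fun S : Finset (Fin 3) => i ∈ S), β S
    ≤ ∑ S ∈ univ.filter (fun S : Finset (Fin 3) => i ∈ S), α S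
  saturated : ∀ U, Saturated U → ∃ V, Saturated V ∧ U ⊆ V ∧ ∑ S ∈ V, α S ≤ ∑ S ∈ U, β S

theorem Improves.refl (α : Finset (Fin 3) → ℝ) : Improves α α :=
  ⟨rfl, fun _ => le_rfl, fun U hU => ⟨U, hU, subset_rfl, le_rfl⟩⟩

theorem Improves.trans {α β γ : Finset (Fin 3) → ℝ} (h : Improves α β) (h' : Improves β γ) :
    Improves α γ := by
  refine ⟨h'.total.trans h.total, fun i => (h'.star i).trans (h.star i), fun U hU => ?_⟩
  obtain ⟨V, hV, hUV, hle⟩ := h'.saturated U hU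
  obtain ⟨W, hW, hVW, hle'⟩ := h.saturated V hV
  exact ⟨W, hW, hUV.trans hVW, hle'.trans hle⟩

theorem Saturated.insert {U : Finset (Finset (Fin 3))} (hU : Saturated U) {A : Finset (Fin 3)}
    (hA : ∀ T, A ⊆ T → T = A ∨ T ∈ U) : Saturated (insert A U) := by
  intro S hS T hST
  rw [Finset.mem_insert] at hS ⊢
  rcases hS with rfl | hS
  · exact hA T hST
  · exact Or.inr (hU S hS T hST)

theorem Saturated.univ_mem {U : Finset (Finset (Fin 3))} (hU : Saturated U) {A : Finset (Fin 3)}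
    (hA : A ∈ U) : Finset.univ ∈ U :=
  hU A hA _ (Finset.subset_univ A)

theorem singleton_subset_cases : ∀ (i : Fin 3) (T : Finset (Fin 3)), {i} ⊆ T →
    T = {i} ∨ T = {i + 1}ᶜ ∨ T = {i + 2}ᶜ ∨ T = Finset.univ := by decide

theorem compl_singleton_subset_cases : ∀ (i : Fin 3) (T : Finset (Fin 3)), {i}ᶜ ⊆ T →
    T = {i}ᶜ ∨ T = Finset.univ := by decide

theorem eq_univ_or_singleton_or_compl : ∀ S : Finset (Fin 3), S ≠ ∅ →
    S = Finset.univ ∨ ∃ i, S = {i} ∨ S = {i}ᶜ := by decide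

/-- Modular exchange: the pairs containing `i` pass mass to `univ` and `{i}`. -/
theorem exists_improves_singleton (α : Finset (Fin 3) → ℝ) (i : Fin 3) :
    ∃ β, Improves α β ∧ 0 ≤ β {i} ∧ ∀ j, 0 ≤ α {j} → 0 ≤ β {j} := by
  by_cases hi : 0 ≤ α {i}
  · exact ⟨α, .refl α, hi, fun _ h => h⟩
  set β : Finset (Fin 3) → ℝ := fun S => α S - α {i} *
    ((if S = Finset.univ then 1 else 0) + (if S = {i} then 1 else 0)
      - (if S = {i + 1}ᶜ then 1 else 0) - (if S = {i + 2}ᶜ then 1 else 0)) with hβ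
  have sum_eq (U : Finset (Finset (Fin 3))) : ∑ S ∈ U, β S = ∑ S ∈ U, α S - α {i} *
      ((if Finset.univ ∈ U then 1 else 0) + (if {i} ∈ U then 1 else 0)
      - (if {i + 1}ᶜ ∈ U then 1 else 0) - (if {i + 2}ᶜ ∈ U then 1 else 0)) := by
    simp only [hβ, Finset.sum_sub_distrib, Finset.sum_add_distrib, ← Finset.mul_sum,
      Finset.sum_ite_eq']
  have singleton_eq : ∀ j : Fin 3, β {j} = if j = i then 0 else α {j} := by
    intro j
    have h₁ : ∀ k l : Fin 3, ({k} : Finset (Fin 3)) ≠ {l}ᶜ := by decide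
    have h₂ : ∀ k : Fin 3, ({k} : Finset (Fin 3)) ≠ Finset.univ := by decide
    by_cases hji : j = i <;> simp [hβ, h₁, h₂, hji]
  refine ⟨β, ⟨?_, fun j => ?_, fun U hU => ?_⟩, by simp [singleton_eq], fun j hj => ?_⟩
  · rw [sum_eq]
    simp
  · rw [sum_eq]
    apply le_of_eq
    fin_cases i <;> fin_cases j <;> simp
  · rw [sum_eq]
    by_cases h₀ : {i} ∈ U
    · have h₁ : {i + 1}ᶜ ∈ U := hU _ h₀ _ (by simp)
      have h₂ : {i + 2}ᶜ ∈ U := hU _ h₀ _ (by simp)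
      exact ⟨U, hU, subset_rfl, by simp [h₀, h₁, h₂, hU.univ_mem h₀]⟩
    by_cases h₁ : {i + 1}ᶜ ∈ U
    · by_cases h₂ : {i + 2}ᶜ ∈ U
      · refine ⟨insert {i} U, hU.insert fun T hT => ?_, Finset.subset_insert _ _, ?_⟩
        · rcases singleton_subset_cases i T hT with rfl | rfl | rfl | rfl
          exacts [.inl rfl, .inr h₁, .inr h₂, .inr (hU.univ_mem h₁)]
        · rw [Finset.sum_insert h₀]
          simp only [h₀, h₁, h₂, hU.univ_mem h₁, if_true, if_false]
          linarith
      · exact ⟨U, hU, subset_rfl, by simp [h₀, h₁, h₂, hU.univ_mem h₁]⟩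
    · refine ⟨U, hU, subset_rfl, ?_⟩
      by_cases h₂ : {i + 2}ᶜ ∈ U
      · simp [h₀, h₁, h₂, hU.univ_mem h₂]
      · simp only [h₀, h₁, h₂, if_false]
        split_ifs <;> linarith
  · rw [singleton_eq]
    split_ifs
    exacts [le_rfl, hj]

/-- Mass passes from `univ` to the pair `{i}ᶜ`. -/
theorem exists_improves_compl_singleton (α : Finset (Fin 3) → ℝ) (i : Fin 3) :
    ∃ β, Improves α β ∧ 0 ≤ β {i}ᶜ ∧ ∀ S, S ≠ Finset.univ → 0 ≤ α S → 0 ≤ β S := by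
  by_cases hi : 0 ≤ α {i}ᶜ
  · exact ⟨α, .refl α, hi, fun _ _ h => h⟩
  set β : Finset (Fin 3) → ℝ := fun S => α S - α {i}ᶜ *
    ((if S = {i}ᶜ then 1 else 0) - (if S = Finset.univ then 1 else 0)) with hβ
  have sum_eq (U : Finset (Finset (Fin 3))) : ∑ S ∈ U, β S = ∑ S ∈ U, α S - α {i}ᶜ *
      ((if {i}ᶜ ∈ U then 1 else 0) - (if Finset.univ ∈ U then 1 else 0)) := by
    simp only [hβ, Finset.sum_sub_distrib, ← Finset.mul_sum, Finset.sum_ite_eq']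
  have eq_of_ne_univ : ∀ S, S ≠ Finset.univ → β S = if S = {i}ᶜ then 0 else α S := by
    intro S hS
    by_cases hSi : S = {i}ᶜ
    · subst hSi
      simp [hβ, hS]
    · simp [hβ, hS, hSi]
  refine ⟨β, ⟨?_, fun j => ?_, fun U hU => ?_⟩, ?_, fun S hS h => ?_⟩
  · rw [sum_eq]
    simp
  · rw [sum_eq]
    by_cases hij : j = i
    · simp [hij]
      linarith
    · simp [hij]
  · rw [sum_eq]
    by_cases h₀ : {i}ᶜ ∈ U
    · exact ⟨U, hU, subset_rfl, by simp [h₀, hU.univ_mem h₀]⟩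
    by_cases h₁ : Finset.univ ∈ U
    · refine ⟨insert {i}ᶜ U, hU.insert fun T hT => ?_, Finset.subset_insert _ _, ?_⟩
      · rcases compl_singleton_subset_cases i T hT with rfl | rfl
        exacts [.inl rfl, .inr h₁]
      · rw [Finset.sum_insert h₀]
        simp only [h₀, h₁, if_true, if_false]
        linarith
    · exact ⟨U, hU, subset_rfl, by simp [h₀, h₁]⟩
  · rw [eq_of_ne_univ _ (by simp), if_pos rfl]
  · rw [eq_of_ne_univ S hS]
    split_ifs
    exacts [le_rfl, h]

theorem exists_improves_nonneg (α : Finset (Fin 3) → ℝ)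
    (hα : ∀ U, Saturated U → 0 ≤ ∑ S ∈ U, α S) :
    ∃ β, Improves α β ∧ ∀ S, S ≠ ∅ → 0 ≤ β S := by
  obtain ⟨β₀, h₀, p₀, -⟩ := exists_improves_singleton α 0
  obtain ⟨β₁, h₁, p₁, q₁⟩ := exists_improves_singleton β₀ 1
  obtain ⟨β₂, h₂, p₂, q₂⟩ := exists_improves_singleton β₁ 2
  have singles : ∀ i : Fin 3, 0 ≤ β₂ {i} := by
    intro i
    fin_cases i
    exacts [q₂ _ (q₁ _ p₀), q₂ _ p₁, p₂]
  obtain ⟨γ₀, k₀, r₀, s₀⟩ := exists_improves_compl_singleton β₂ 0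
  obtain ⟨γ₁, k₁, r₁, s₁⟩ := exists_improves_compl_singleton γ₀ 1
  obtain ⟨γ₂, k₂, r₂, s₂⟩ := exists_improves_compl_singleton γ₁ 2
  have h : Improves α γ₂ := (((((h₀.trans h₁).trans h₂).trans k₀).trans k₁).trans k₂)
  refine ⟨γ₂, h, fun S hS => ?_⟩
  rcases eq_univ_or_singleton_or_compl S hS with rfl | ⟨i, rfl | rfl⟩
  · have hsat : Saturated {Finset.univ} := by
      intro S hS T hST
      rw [Finset.mem_singleton] at hS ⊢
      exact Finset.univ_subset_iff.mp (hS ▸ hST)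
    obtain ⟨V, hV, -, hle⟩ := h.saturated _ hsat
    simpa using (hα V hV).trans hle
  · have hne : ({i} : Finset (Fin 3)) ≠ Finset.univ := by revert i; decide
    exact s₂ _ hne (s₁ _ hne (s₀ _ hne (singles i)))
  · have hne : ∀ j : Fin 3, ({j}ᶜ : Finset (Fin 3)) ≠ Finset.univ := by decide
    fin_cases i
    exacts [s₂ _ (hne 0) (s₁ _ (hne 0) r₀), s₂ _ (hne 1) r₁, r₂]

/-- in the rate region for three public receivers, the constraint family
`α_S ≥ 0 for all S ≠ ∅` can be replaced by `Σ_{S∈Λ} α_S ≥ 0 for all superset-saturated Λ`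
without changing the projection onto `(R₁,R₂)`. -/
theorem stmt17 {P : Type*} [Fintype P]
    (E : Finset (Fin 3) → ℝ) (Ep : Finset (Fin 3) → P → ℝ)
    (hE : ∀ S, 0 ≤ E S) (hEp : ∀ S p, 0 ≤ Ep S p) (hEpE : ∀ S p, Ep S p ≤ E S) :
    {x : ℝ × ℝ | 0 ≤ x.1 ∧ 0 ≤ x.2 ∧
        ∃ α : Finset (Fin 3) → ℝ,
          (∀ S : Finset (Fin 3), S ≠ ∅ → 0 ≤ α S) ∧
          x.2 = ∑ S : Finset (Fin 3), α S ∧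
          (∀ i : Fin 3,
            x.1 + ∑ S ∈ Finset.univ.filter (fun S : Finset (Fin 3) => i ∈ S), α S
              ≤ ∑ S ∈ Finset.univ.filter (fun S : Finset (Fin 3) => i ∈ S), E S) ∧
          (∀ p : P, ∀ Λ : Finset (Finset (Fin 3)), Saturated Λ →
            x.2 ≤ ∑ S ∈ Λ, α S + ∑ S ∈ Λᶜ, Ep S p) ∧
          (∀ p : P, x.1 + x.2 ≤ ∑ S : Finset (Fin 3), Ep S p)} =
    {x : ℝ × ℝ | 0 ≤ x.1 ∧ 0 ≤ x.2 ∧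
        ∃ α : Finset (Fin 3) → ℝ,
          (∀ Λ : Finset (Finset (Fin 3)), Saturated Λ → 0 ≤ ∑ S ∈ Λ, α S) ∧
          x.2 = ∑ S : Finset (Fin 3), α S ∧
          (∀ i : Fin 3,
            x.1 + ∑ S ∈ Finset.univ.filter (fun S : Finset (Fin 3) => i ∈ S), α S
              ≤ ∑ S ∈ Finset.univ.filter (fun S : Finset (Fin 3) => i ∈ S), E S) ∧
          (∀ p : P, ∀ Λ : Finset (Finset (Fin 3)), Saturated Λ →
            x.2 ≤ ∑ S ∈ Λ, α S + ∑ S ∈ Λᶜ, Ep S p) ∧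
          (∀ p : P, x.1 + x.2 ≤ ∑ S : Finset (Fin 3), Ep S p)} := by
  ext ⟨R₁, R₂⟩
  simp only [Set.mem_ofPred_eq]
  refine and_congr_right fun _ => and_congr_right fun hR₂ => ⟨?_, ?_⟩
  · rintro ⟨α, hα, htot, h⟩
    refine ⟨α, fun Λ hΛ => ?_, htot, h⟩
    by_cases hempty : ∅ ∈ Λ
    · have hΛ_univ : Λ = Finset.univ :=
        Finset.eq_univ_of_forall fun T => hΛ _ hempty T (Finset.empty_subset T)
      rw [hΛ_univ, ← htot]
      exact hR₂
    · exact Finset.sum_nonneg fun S hS => hα S fun h => hempty (h ▸ hS)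
  · rintro ⟨α, hα, htot, hpub, hpriv, hsum⟩
    obtain ⟨β, hβ, hβ_nonneg⟩ := exists_improves_nonneg α hα
    refine ⟨β, hβ_nonneg, htot.trans hβ.total.symm, fun i => ?_, fun p Λ hΛ => ?_, hsum⟩
    · exact (add_le_add_right (hβ.star i) R₁).trans (hpub i)
    · obtain ⟨V, hV, hΛV, hle⟩ := hβ.saturated Λ hΛ
      exact (hpriv p V hV).trans (add_le_add hle (Finset.sum_le_sum_of_subset_of_nonneg
        (Finset.compl_subset_compl.mpr hΛV) fun S _ _ => hEp S p))
end
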